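/- Let r be an integer with 3 ≤ r ≤ 8 and let P_r := {x ∈ Nef_r : B(−K_r, x) = 1}. Then the face of P_r cut out by the exceptional class e_r = (0,…,0,1) is the embedded polytope of S_{r−1}: {x ∈ P_r : B(e_r, x) = 0} = ι({y ∈ Nef_{r−1} : B(−K_{r−1}, y) = 1}). -/

import Mathlib

open scoped BigOperators
open MeasureTheory

/-- Intersection form on `ℤ^(n+1)` with basis `H, E₁, …, E_n`:
`B(x,y) = x₀y₀ - x₁y₁ - ⋯ - x_n y_n` (written as `2x₀y₀ - ∑ᵢ xᵢyᵢ`). -/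
def interZ {n : ℕ} (x y : Fin (n + 1) → ℤ) : ℤ :=
  2 * x 0 * y 0 - ∑ i, x i * y i

/-- The real intersection form on `ℝ^(n+1)`. -/
def interR {n : ℕ} (x y : Fin (n + 1) → ℝ) : ℝ :=
  2 * x 0 * y 0 - ∑ i, x i * y i

/-- The anticanonical class `-K = (3, -1, …, -1)`. -/
def antiK (n : ℕ) : Fin (n + 1) → ℤ := fun i => if i = 0 then 3 else -1

/-- The anticanonical class as a real vector. -/
def antiKR (n : ℕ) : Fin (n + 1) → ℝ := fun i => if i = 0 then 3 else -1

/-- A `(-1)`-class: `B(E,E) = -1` and `B(-K,E) = 1`. -/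
def IsMinusOneClass {n : ℕ} (E : Fin (n + 1) → ℤ) : Prop :=
  interZ E E = -1 ∧ interZ (antiK n) E = 1

/-- The nef cone: real vectors pairing nonnegatively with every `(-1)`-class. -/
def NefCone (n : ℕ) : Set (Fin (n + 1) → ℝ) :=
  {x | ∀ E : Fin (n + 1) → ℤ, IsMinusOneClass E → 0 ≤ interR (fun i => (E i : ℝ)) x}

lemma interZ_eq_sub_sum_succ {n : ℕ} (x y : Fin (n + 1) → ℤ) :
    interZ x y = x 0 * y 0 - ∑ i : Fin n, x i.succ * y i.succ := by
  rw [interZ, Fin.sum_univ_succ]; ring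

lemma interR_eq_sub_sum_succ {n : ℕ} (x y : Fin (n + 1) → ℝ) :
    interR x y = x 0 * y 0 - ∑ i : Fin n, x i.succ * y i.succ := by
  rw [interR, Fin.sum_univ_succ]; ring

lemma interZ_comm {n : ℕ} (x y : Fin (n + 1) → ℤ) : interZ x y = interZ y x := by
  simp only [interZ_eq_sub_sum_succ, mul_comm]

lemma interR_comm {n : ℕ} (x y : Fin (n + 1) → ℝ) : interR x y = interR y x := by
  simp only [interR_eq_sub_sum_succ, mul_comm]

lemma interZ_add_smul_left {n : ℕ} (c : ℤ) (x z y : Fin (n + 1) → ℤ) :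
    interZ (x + c • z) y = interZ x y + c * interZ z y := by
  simp only [interZ_eq_sub_sum_succ, Pi.add_apply, Pi.smul_apply, smul_eq_mul, add_mul,
    Finset.sum_add_distrib, mul_assoc, ← Finset.mul_sum]
  ring

lemma interR_add_smul_left {n : ℕ} (c : ℝ) (x z y : Fin (n + 1) → ℝ) :
    interR (x + c • z) y = interR x y + c * interR z y := by
  simp only [interR_eq_sub_sum_succ, Pi.add_apply, Pi.smul_apply, smul_eq_mul, add_mul,
    Finset.sum_add_distrib, mul_assoc, ← Finset.mul_sum]
  ring

lemma interZ_add_smul_right {n : ℕ} (c : ℤ) (x z y : Fin (n + 1) → ℤ) :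
    interZ y (x + c • z) = interZ y x + c * interZ y z := by
  rw [interZ_comm, interZ_add_smul_left, interZ_comm x, interZ_comm z]

lemma interR_add_smul_right {n : ℕ} (c : ℝ) (x z y : Fin (n + 1) → ℝ) :
    interR y (x + c • z) = interR y x + c * interR y z := by
  rw [interR_comm, interR_add_smul_left, interR_comm x, interR_comm z]

lemma interR_intCast {n : ℕ} (x y : Fin (n + 1) → ℤ) :
    interR (fun i => (x i : ℝ)) (fun i => (y i : ℝ)) = interZ x y := by
  simp [interR, interZ]

lemma antiKR_eq_intCast (n : ℕ) : antiKR n = fun i => (antiK n i : ℝ) := by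
  funext i
  simp only [antiKR, antiK]
  split_ifs <;> simp

lemma interZ_antiK {n : ℕ} (x : Fin (n + 1) → ℤ) :
    interZ (antiK n) x = 3 * x 0 + ∑ i : Fin n, x i.succ := by
  simp [interZ_eq_sub_sum_succ, antiK, Fin.succ_ne_zero]

lemma interR_antiKR {n : ℕ} (x : Fin (n + 1) → ℝ) :
    interR (antiKR n) x = 3 * x 0 + ∑ i : Fin n, x i.succ := by
  simp [interR_eq_sub_sum_succ, antiKR, Fin.succ_ne_zero]

/-- The class `E_a`. -/
def exceptionalClass {n : ℕ} (a : Fin n) : Fin (n + 1) → ℤ :=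
  Fin.cons 0 (Pi.single a 1)

/-- The class `H - E_a - E_b` of the line through two of the blown-up points. -/
def lineClass {n : ℕ} (a b : Fin n) : Fin (n + 1) → ℤ :=
  Fin.cons 1 (-Pi.single a 1 - Pi.single b 1)

/-- The root `H - E_a - E_b - E_c`, whose reflection is a quadratic Cremona transformation. -/
def cremonaRoot {n : ℕ} (a b c : Fin n) : Fin (n + 1) → ℤ :=
  Fin.cons 1 (-Pi.single a 1 - Pi.single b 1 - Pi.single c 1)

lemma sum_single_mul {n : ℕ} (a : Fin n) (f : Fin n → ℤ) :
    ∑ i, (Pi.single a 1 : Fin n → ℤ) i * f i = f a := by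
  simp [Pi.single_apply]

lemma sum_intCast_single_mul {n : ℕ} (a : Fin n) (f : Fin n → ℝ) :
    ∑ i, (((Pi.single a 1 : Fin n → ℤ) i : ℤ) : ℝ) * f i = f a := by
  simp [Pi.single_apply]

lemma interZ_exceptionalClass {n : ℕ} (a : Fin n) (x : Fin (n + 1) → ℤ) :
    interZ (exceptionalClass a) x = -x a.succ := by
  simp [interZ_eq_sub_sum_succ, exceptionalClass, sum_single_mul]

lemma interR_exceptionalClass {n : ℕ} (a : Fin n) (x : Fin (n + 1) → ℝ) :
    interR (fun i => (exceptionalClass a i : ℝ)) x = -x a.succ := by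
  simp [interR_eq_sub_sum_succ, exceptionalClass, sum_intCast_single_mul]

lemma interZ_lineClass {n : ℕ} (a b : Fin n) (x : Fin (n + 1) → ℤ) :
    interZ (lineClass a b) x = x 0 + x a.succ + x b.succ := by
  simp only [interZ_eq_sub_sum_succ, lineClass, Fin.cons_zero, Fin.cons_succ, Pi.sub_apply,
    Pi.neg_apply, sub_mul, neg_mul, Finset.sum_sub_distrib, Finset.sum_neg_distrib, sum_single_mul]
  ring

lemma interR_lineClass {n : ℕ} (a b : Fin n) (x : Fin (n + 1) → ℝ) :
    interR (fun i => (lineClass a b i : ℝ)) x = x 0 + x a.succ + x b.succ := by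
  simp only [interR_eq_sub_sum_succ, lineClass, Fin.cons_zero, Fin.cons_succ, Pi.sub_apply,
    Pi.neg_apply, Int.cast_sub, Int.cast_neg, Int.cast_one, sub_mul, neg_mul,
    Finset.sum_sub_distrib, Finset.sum_neg_distrib, sum_intCast_single_mul]
  ring

lemma interZ_cremonaRoot {n : ℕ} (a b c : Fin n) (x : Fin (n + 1) → ℤ) :
    interZ (cremonaRoot a b c) x = x 0 + x a.succ + x b.succ + x c.succ := by
  simp only [interZ_eq_sub_sum_succ, cremonaRoot, Fin.cons_zero, Fin.cons_succ, Pi.sub_apply,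
    Pi.neg_apply, sub_mul, neg_mul, Finset.sum_sub_distrib, Finset.sum_neg_distrib, sum_single_mul]
  ring

lemma isMinusOneClass_exceptionalClass {n : ℕ} (a : Fin n) :
    IsMinusOneClass (exceptionalClass a) := by
  refine ⟨?_, ?_⟩
  · rw [interZ_exceptionalClass]; simp [exceptionalClass]
  · rw [interZ_comm, interZ_exceptionalClass]; simp [antiK, Fin.succ_ne_zero]

lemma isMinusOneClass_lineClass {n : ℕ} {a b : Fin n} (hab : a ≠ b) :
    IsMinusOneClass (lineClass a b) := by
  refine ⟨?_, ?_⟩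
  · rw [interZ_lineClass]; simp [lineClass, hab, hab.symm]
  · rw [interZ_comm, interZ_lineClass]; simp [antiK, Fin.succ_ne_zero]

lemma interZ_cremonaRoot_self {n : ℕ} {a b c : Fin n} (hab : a ≠ b) (hac : a ≠ c) (hbc : b ≠ c) :
    interZ (cremonaRoot a b c) (cremonaRoot a b c) = -2 := by
  rw [interZ_cremonaRoot]
  simp [cremonaRoot, hab, hab.symm, hac, hac.symm, hbc, hbc.symm]

lemma interZ_antiK_cremonaRoot {n : ℕ} (a b c : Fin n) :
    interZ (antiK n) (cremonaRoot a b c) = 0 := by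
  rw [interZ_comm, interZ_cremonaRoot]; simp [antiK, Fin.succ_ne_zero]

/-- The reflection in a `(-2)`-vector preserves the self-intersection. -/
lemma interZ_reflection_self {n : ℕ} {α : Fin (n + 1) → ℤ} (hα : interZ α α = -2)
    (x : Fin (n + 1) → ℤ) :
    interZ (x + interZ α x • α) (x + interZ α x • α) = interZ x x := by
  simp only [interZ_add_smul_left, interZ_add_smul_right, hα, interZ_comm x α]
  ring

/-- The reflection in a `(-2)`-vector orthogonal to `K` preserves the anticanonical degree. -/
lemma interZ_antiK_reflection {n : ℕ} {α : Fin (n + 1) → ℤ} (hK : interZ (antiK n) α = 0)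
    (x : Fin (n + 1) → ℤ) :
    interZ (antiK n) (x + interZ α x • α) = interZ (antiK n) x := by
  rw [interZ_add_smul_right, hK, mul_zero, add_zero]

lemma IsMinusOneClass.reflection {n : ℕ} {α E : Fin (n + 1) → ℤ} (hα : interZ α α = -2)
    (hK : interZ (antiK n) α = 0) (hE : IsMinusOneClass E) :
    IsMinusOneClass (E + interZ α E • α) :=
  ⟨(interZ_reflection_self hα E).trans hE.1, (interZ_antiK_reflection hK E).trans hE.2⟩

lemma intCast_add_smul {n : ℕ} (c : ℤ) (x z : Fin (n + 1) → ℤ) :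
    (fun i => ((x + c • z) i : ℝ)) = (fun i => (x i : ℝ)) + (c : ℝ) • fun i => (z i : ℝ) := by
  funext i; simp

/-- Reflections are self-adjoint for the intersection form. -/
lemma interR_reflection_left {n : ℕ} (α E : Fin (n + 1) → ℤ) (x : Fin (n + 1) → ℝ) :
    interR (fun i => ((E + interZ α E • α) i : ℝ)) x =
      interR (fun i => (E i : ℝ)) (x + interR (fun i => (α i : ℝ)) x • fun i => (α i : ℝ)) := by
  rw [intCast_add_smul, interR_add_smul_left, interR_add_smul_right, interR_intCast,
    interZ_comm E α]
  ring

lemma reflection_mem_nefCone {n : ℕ} {α : Fin (n + 1) → ℤ} (hα : interZ α α = -2)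
    (hK : interZ (antiK n) α = 0) {x : Fin (n + 1) → ℝ} (hx : x ∈ NefCone n) :
    x + interR (fun i => (α i : ℝ)) x • (fun i => (α i : ℝ)) ∈ NefCone n := by
  intro E hE
  rw [← interR_reflection_left]
  exact hx _ (hE.reflection hα hK)

/-- Reflections are isometries. -/
lemma interR_reflection {n : ℕ} {α : Fin (n + 1) → ℤ} (hα : interZ α α = -2)
    (E : Fin (n + 1) → ℤ) (x : Fin (n + 1) → ℝ) :
    interR (fun i => ((E + interZ α E • α) i : ℝ))
      (x + interR (fun i => (α i : ℝ)) x • fun i => (α i : ℝ)) =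
      interR (fun i => (E i : ℝ)) x := by
  rw [intCast_add_smul]
  simp only [interR_add_smul_left, interR_add_smul_right, interR_intCast, hα, interZ_comm E α]
  push_cast
  ring

lemma sq_sum_succ_le {n : ℕ} (hn : n ≤ 7) (D : Fin (n + 1) → ℤ) :
    (∑ i : Fin n, D i.succ) ^ 2 ≤ 7 * ∑ i : Fin n, D i.succ * D i.succ := by
  have h := sq_sum_le_card_mul_sum_sq (s := Finset.univ) (f := fun i : Fin n => D i.succ)
  simp only [Finset.card_univ, Fintype.card_fin, sq (D _)] at h
  have h0 : 0 ≤ ∑ i : Fin n, D i.succ * D i.succ :=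
    Finset.sum_nonneg fun i _ => mul_self_nonneg _
  have hn' : (n : ℤ) ≤ 7 := by exact_mod_cast hn
  exact h.trans (mul_le_mul_of_nonneg_right hn' h0)

/-- The Hodge index inequality on a surface with `K² ≥ 2`. -/
lemma two_mul_interZ_self_le {n : ℕ} (hn : n ≤ 7) (D : Fin (n + 1) → ℤ) :
    2 * interZ D D ≤ interZ (antiK n) D ^ 2 := by
  have h := sq_sum_succ_le hn D
  rw [interZ_antiK, interZ_eq_sub_sum_succ]
  nlinarith [sq_nonneg (7 * D 0 + 3 * ∑ i : Fin n, D i.succ)]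

lemma degree_nonneg {n : ℕ} (hn : n ≤ 7) {D : Fin (n + 1) → ℤ} (hD : 0 ≤ interZ D D)
    (hK : 0 ≤ interZ (antiK n) D) : 0 ≤ D 0 := by
  have h := sq_sum_succ_le hn D
  rw [interZ_antiK] at hK
  rw [interZ_eq_sub_sum_succ] at hD
  by_contra! h0
  nlinarith

/-- A reduced class pairs nonnegatively with a vector `(y₀, -p)` satisfying
the inequalities of the nef cone coming from exceptional classes, lines and `-K`. -/
lemma sum_mul_le_of_reduced {n : ℕ} {a b c : Fin n} (hab : a ≠ b)
    {d₀ y₀ : ℝ} {d p : Fin n → ℝ} (hp : ∀ i, 0 ≤ p i) (hpy : ∀ i, p i ≤ y₀)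
    (hK : ∑ i, p i ≤ 3 * y₀) (hc : 0 ≤ d c) (hca : d c ≤ d a) (hcb : d c ≤ d b)
    (hmax : ∀ i, i ≠ a → i ≠ b → d i ≤ d c) (hred : d a + d b + d c ≤ d₀) :
    ∑ i, d i * p i ≤ d₀ * y₀ := by
  have h : ∑ i, (d i - d c) * p i ≤ ∑ i ∈ {a, b}, (d i - d c) * p i := by
    rw [← Finset.sum_add_sum_compl {a, b}]
    refine add_le_of_nonpos_right (Finset.sum_nonpos fun i hi => ?_)
    simp only [Finset.mem_compl, Finset.mem_insert, Finset.mem_singleton, not_or] at hi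
    exact mul_nonpos_of_nonpos_of_nonneg (by linarith [hmax i hi.1 hi.2]) (hp i)
  rw [Finset.sum_pair hab] at h
  simp only [sub_mul, Finset.sum_sub_distrib, ← Finset.mul_sum] at h
  have hy : 0 ≤ y₀ := (hp a).trans (hpy a)
  nlinarith [mul_le_mul_of_nonneg_left hK hc, mul_le_mul_of_nonneg_left (hpy a) (sub_nonneg.2 hca),
    mul_le_mul_of_nonneg_left (hpy b) (sub_nonneg.2 hcb), mul_le_mul_of_nonneg_right hred hy]

lemma sum_mul_le_of_nonpos_off_pair {n : ℕ} {a b : Fin n} (hab : a ≠ b) {d₀ y₀ : ℝ}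
    {d p : Fin n → ℝ} (hp : ∀ i, 0 ≤ p i) (hpy : p a + p b ≤ y₀) (hd₀ : 0 ≤ d₀)
    (ha : d a ≤ d₀) (hb : d b ≤ d₀) (hd : ∀ i, i ≠ a → i ≠ b → d i ≤ 0) :
    ∑ i, d i * p i ≤ d₀ * y₀ := by
  have h : ∑ i, d i * p i ≤ ∑ i ∈ {a, b}, d i * p i := by
    rw [← Finset.sum_add_sum_compl {a, b}]
    refine add_le_of_nonpos_right (Finset.sum_nonpos fun i hi => ?_)
    simp only [Finset.mem_compl, Finset.mem_insert, Finset.mem_singleton, not_or] at hi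
    exact mul_nonpos_of_nonpos_of_nonneg (hd i hi.1 hi.2) (hp i)
  rw [Finset.sum_pair hab] at h
  nlinarith [mul_le_mul_of_nonneg_right ha (hp a), mul_le_mul_of_nonneg_right hb (hp b),
    mul_le_mul_of_nonneg_left hpy hd₀]

/-- An integral class in the positive cone pairs nonnegatively with every nef vector. -/
lemma interR_nonneg_of_interZ_self_nonneg {n : ℕ} (h2 : 2 ≤ n) (h7 : n ≤ 7)
    (D : Fin (n + 1) → ℤ) (hD : 0 ≤ interZ D D) (hDK : 0 ≤ interZ (antiK n) D)
    (y : Fin (n + 1) → ℝ) (hy : y ∈ NefCone n) (hyK : 0 ≤ interR (antiKR n) y) :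
    0 ≤ interR (fun i => (D i : ℝ)) y := by
  induction hN : (D 0).toNat using Nat.strong_induction_on generalizing D y with
  | _ N ih =>
  have hD0 := degree_nonneg h7 hD hDK
  have hp : ∀ i : Fin n, 0 ≤ -y i.succ := fun i => by
    simpa only [interR_exceptionalClass] using hy _ (isMinusOneClass_exceptionalClass i)
  have hline : ∀ a b : Fin n, a ≠ b → -y a.succ + -y b.succ ≤ y 0 := fun a b hab => by
    have := hy _ (isMinusOneClass_lineClass hab)
    rw [interR_lineClass] at this
    linarith
  have hle : ∀ i : Fin n, -D i.succ ≤ D 0 := fun i => by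
    have h1 : D i.succ * D i.succ ≤ ∑ j : Fin n, D j.succ * D j.succ :=
      Finset.single_le_sum (f := fun j : Fin n => D j.succ * D j.succ)
        (fun j _ => mul_self_nonneg _) (Finset.mem_univ i)
    rw [interZ_eq_sub_sum_succ] at hD
    nlinarith
  have key : ∑ i : Fin n, (-D i.succ : ℝ) * (-y i.succ) ≤ D 0 * y 0 →
      0 ≤ interR (fun i => (D i : ℝ)) y := fun h => by
    rw [interR_eq_sub_sum_succ]
    simpa only [neg_mul_neg, sub_nonneg] using h
  have hne : (Finset.univ : Finset (Fin n)).Nonempty := ⟨⟨0, by omega⟩, Finset.mem_univ _⟩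
  obtain ⟨a, -, ha⟩ := Finset.exists_max_image Finset.univ (fun i : Fin n => -D i.succ) hne
  have hne' : (Finset.univ.erase a).Nonempty := by
    rw [← Finset.card_pos, Finset.card_erase_of_mem (Finset.mem_univ a), Finset.card_univ,
      Fintype.card_fin]
    omega
  obtain ⟨b, hba, hb⟩ := Finset.exists_max_image _ (fun i : Fin n => -D i.succ) hne'
  have hab : a ≠ b := (Finset.ne_of_mem_erase hba).symm
  by_cases hsmall : ∀ i : Fin n, i ≠ a → i ≠ b → -D i.succ ≤ 0
  · apply key
    exact sum_mul_le_of_nonpos_off_pair (d := fun i => (-D i.succ : ℝ))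
      (p := fun i => -y i.succ) hab hp (hline a b hab) (by exact_mod_cast hD0)
      (by exact_mod_cast hle a) (by exact_mod_cast hle b)
      (fun i h h' => by exact_mod_cast hsmall i h h')
  push Not at hsmall
  obtain ⟨j, hja, hjb, hj⟩ := hsmall
  obtain ⟨c, hcm, hc⟩ := Finset.exists_max_image ((Finset.univ.erase a).erase b)
    (fun i : Fin n => -D i.succ) ⟨j, by simp [hja, hjb]⟩
  have hcb : c ≠ b := Finset.ne_of_mem_erase hcm
  have hca : c ≠ a := Finset.ne_of_mem_erase (Finset.mem_of_mem_erase hcm)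
  have hc0 : 0 ≤ -D c.succ := hj.le.trans (hc j (by simp [hja, hjb]))
  by_cases hred : -D a.succ + -D b.succ + -D c.succ ≤ D 0
  · apply key
    refine sum_mul_le_of_reduced (d := fun i => (-D i.succ : ℝ))
      (p := fun i => -y i.succ) hab hp (fun i => ?_) ?_
      (by exact_mod_cast hc0) (by exact_mod_cast ha c (Finset.mem_univ c))
      (by exact_mod_cast hb c (Finset.mem_of_mem_erase hcm))
      (fun i h h' => by exact_mod_cast hc i (by simp [h, h'])) (by exact_mod_cast hred)
    · obtain rfl | h := eq_or_ne i a
      · linarith [hline i b hab, hp b]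
      · linarith [hline i a h, hp a]
    · rw [interR_antiKR] at hyK
      rw [Finset.sum_neg_distrib]
      linarith
  · have hα := interZ_cremonaRoot_self hab hca.symm hcb.symm
    have hαK := interZ_antiK_cremonaRoot a b c
    rw [← interR_reflection hα D y]
    have hD' := (interZ_reflection_self hα D).symm ▸ hD
    have hDK' := (interZ_antiK_reflection hαK D).symm ▸ hDK
    have hD0' := degree_nonneg h7 hD' hDK'
    refine ih _ ?_ _ hD' hDK' _ (reflection_mem_nefCone hα hαK hy) ?_ rfl
    · have h0 : (D + interZ (cremonaRoot a b c) D • cremonaRoot a b c) 0 =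
          D 0 + interZ (cremonaRoot a b c) D := by simp [cremonaRoot]
      rw [h0, interZ_cremonaRoot] at hD0' ⊢
      omega
    · rw [interR_add_smul_right, antiKR_eq_intCast, interR_intCast, hαK, ← antiKR_eq_intCast]
      simpa using hyK

lemma interZ_eq_castSucc_sub_last {n : ℕ} (x y : Fin (n + 2) → ℤ) :
    interZ x y = interZ (fun i => x (Fin.castSucc i)) (fun i => y (Fin.castSucc i))
      - x (Fin.last _) * y (Fin.last _) := by
  rw [interZ, interZ, Fin.sum_univ_castSucc]
  simp only [Fin.castSucc_zero]
  ring

lemma interR_eq_castSucc_sub_last {n : ℕ} (x y : Fin (n + 2) → ℝ) :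
    interR x y = interR (fun i => x (Fin.castSucc i)) (fun i => y (Fin.castSucc i))
      - x (Fin.last _) * y (Fin.last _) := by
  rw [interR, interR, Fin.sum_univ_castSucc]
  simp only [Fin.castSucc_zero]
  ring

lemma antiK_castSucc (n : ℕ) : (fun i => antiK (n + 1) (Fin.castSucc i)) = antiK n := by
  funext i; simp [antiK]

lemma antiKR_castSucc (n : ℕ) : (fun i => antiKR (n + 1) (Fin.castSucc i)) = antiKR n := by
  funext i; simp [antiKR]

lemma interR_snoc_zero {n : ℕ} (x : Fin (n + 2) → ℝ) (y : Fin (n + 1) → ℝ) :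
    interR x (Fin.snoc y 0 : Fin (n + 2) → ℝ) = interR (fun i => x (Fin.castSucc i)) y := by
  rw [interR_eq_castSucc_sub_last]; simp

lemma interR_last {n : ℕ} (x : Fin (n + 2) → ℝ) :
    interR (fun i => if i = Fin.last (n + 1) then (1 : ℝ) else 0) x = -x (Fin.last (n + 1)) := by
  simp [interR]

lemma IsMinusOneClass.snoc_zero {n : ℕ} {E : Fin (n + 1) → ℤ} (hE : IsMinusOneClass E) :
    IsMinusOneClass (Fin.snoc E 0 : Fin (n + 2) → ℤ) := by
  refine ⟨?_, ?_⟩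
  · rw [interZ_eq_castSucc_sub_last]; simpa using hE.1
  · rw [interZ_eq_castSucc_sub_last, antiK_castSucc]; simpa using hE.2

/-- The pullback of a vector along the last blow-up is nef if and only if the vector is. -/
lemma snoc_zero_mem_nefCone_iff {n : ℕ} (h2 : 2 ≤ n) (h7 : n ≤ 7) {y : Fin (n + 1) → ℝ}
    (hyK : 0 ≤ interR (antiKR n) y) :
    (Fin.snoc y 0 : Fin (n + 2) → ℝ) ∈ NefCone (n + 1) ↔ y ∈ NefCone n := by
  refine ⟨fun h E hE => ?_, fun hy E hE => ?_⟩
  · simpa [interR_snoc_zero] using h _ hE.snoc_zero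
  rw [interR_snoc_zero]
  set D : Fin (n + 1) → ℤ := fun i => E (Fin.castSucc i) with hDdef
  have h1 : interZ D D = E (Fin.last _) ^ 2 - 1 := by
    have := hE.1
    rw [interZ_eq_castSucc_sub_last, ← hDdef] at this
    linarith
  have hK : interZ (antiK n) D = 1 - E (Fin.last _) := by
    have := hE.2
    rw [interZ_eq_castSucc_sub_last, antiK_castSucc, ← hDdef, antiK,
      if_neg (Fin.last_pos).ne'] at this
    linarith
  have hodge := two_mul_interZ_self_le h7 D
  rw [h1, hK] at hodge
  have he : E (Fin.last _) ≤ 1 := by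
    by_contra! h
    nlinarith
  obtain h0 | h0 := eq_or_ne (E (Fin.last (n + 1))) 0
  · exact hy D ⟨by rw [h1, h0]; norm_num, by rw [hK, h0]; norm_num⟩
  · refine interR_nonneg_of_interZ_self_nonneg h2 h7 D ?_ ?_ y hy hyK
    · rw [h1]
      have := Int.one_le_abs h0
      nlinarith [sq_abs (E (Fin.last (n + 1)))]
    · rw [hK]; linarith

theorem polytope_face_eq_embedded_polytope (s : ℕ) (h3 : 3 ≤ s + 1) (h8 : s + 1 ≤ 8) :
    {x | x ∈ NefCone (s + 1) ∧ interR (antiKR (s + 1)) x = 1 ∧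
        interR (fun i => if i = Fin.last (s + 1) then (1 : ℝ) else 0) x = 0}
      = (fun y : Fin (s + 1) → ℝ => Fin.snoc y 0) ''
          {y | y ∈ NefCone s ∧ interR (antiKR s) y = 1} := by
  have hK : ∀ y : Fin (s + 1) → ℝ,
      interR (antiKR (s + 1)) (Fin.snoc y 0 : Fin (s + 2) → ℝ) = interR (antiKR s) y := fun y => by
    rw [interR_snoc_zero, antiKR_castSucc]
  have hnef : ∀ y : Fin (s + 1) → ℝ, interR (antiKR s) y = 1 →
      ((Fin.snoc y 0 : Fin (s + 2) → ℝ) ∈ NefCone (s + 1) ↔ y ∈ NefCone s) := fun y hy =>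
    snoc_zero_mem_nefCone_iff (by omega) (by omega) (hy ▸ zero_le_one)
  ext x
  constructor
  · rintro ⟨hx, hx1, hx0⟩
    rw [interR_last, neg_eq_zero] at hx0
    have hsnoc : (Fin.snoc (fun i => x (Fin.castSucc i)) 0 : Fin (s + 2) → ℝ) = x := by
      rw [← hx0]; exact Fin.snoc_init_self x
    rw [← hsnoc] at hx hx1
    rw [hK] at hx1
    exact ⟨_, ⟨(hnef _ hx1).1 hx, hx1⟩, hsnoc⟩
  · rintro ⟨y, ⟨hy, hy1⟩, rfl⟩
    refine ⟨(hnef y hy1).2 hy, (hK y).trans hy1, ?_⟩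
    rw [interR_last]
    simp
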